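/- arXiv:1909.03440 — 2 statements merged into one kernel-verified Lean document; each statement's English description precedes it below -/
import Mathlib

section
/- Let R be a ring such that the right R-module R has finite uniform dimension. Suppose that any pair of Baer right R-modules N and K are isomorphic whenever N is isomorphic to a submodule of K and K is isomorphic to a direct summand of N. Then the quotient ring R/Z₂(R) is a semisimple Artinian ring, where Z₂(R) denotes the second singular submodule of the right R-module R. -/
universe u v

section Defs

variable (R : Type u) [Ring R]

/-- A submodule `N` of `M` is a direct summand of `M`. -/
def IsDirectSummand {M : Type v} [AddCommGroup M] [Module R M] (N : Submodule R M) : Prop :=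
  ∃ N' : Submodule R M, IsCompl N N'

/-- `N` is isomorphic (as an `R`-module) to a direct summand of `K`. -/
def IsoToDirectSummand (N : Type*) [AddCommGroup N] [Module R N]
    (K : Type*) [AddCommGroup K] [Module R K] : Prop :=
  ∃ L : Submodule R K, IsDirectSummand R L ∧ Nonempty (N ≃ₗ[R] L)

/-- `N` and `K` are d-subisomorphic to each other. -/
def DSubisomorphic (N : Type*) [AddCommGroup N] [Module R N]
    (K : Type*) [AddCommGroup K] [Module R K] : Prop :=
  IsoToDirectSummand R N K ∧ IsoToDirectSummand R K N

/-- `N` and `K` are subisomorphic to each other: each embeds in the other. -/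
def Subisomorphic (N : Type*) [AddCommGroup N] [Module R N]
    (K : Type*) [AddCommGroup K] [Module R K] : Prop :=
  (∃ f : N →ₗ[R] K, Function.Injective f) ∧ (∃ g : K →ₗ[R] N, Function.Injective g)

/-- A module is Rickart if kernels of endomorphisms are direct summands. -/
def IsRickartModule (M : Type v) [AddCommGroup M] [Module R M] : Prop :=
  ∀ f : Module.End R M, IsDirectSummand R (LinearMap.ker f)

/-- A module is Baer if for every submodule `N`, the annihilator of `N` in the
endomorphism ring `S` is generated, as a left ideal of `S`, by an idempotent. -/
def IsBaerModule (M : Type v) [AddCommGroup M] [Module R M] : Prop :=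
  ∀ N : Submodule R M, ∃ e : Module.End R M, IsIdempotentElem e ∧
    ∀ f : Module.End R M, (∀ x ∈ N, f x = 0) ↔ ∃ g : Module.End R M, f = g * e

/-- A module is dual Rickart if images of endomorphisms are direct summands. -/
def IsDualRickartModule (M : Type v) [AddCommGroup M] [Module R M] : Prop :=
  ∀ f : Module.End R M, IsDirectSummand R (LinearMap.range f)

/-- A module is dual Baer if for every submodule `N`, the set of endomorphisms with
image contained in `N` is generated, as a right ideal of the endomorphism ring, by
an idempotent. -/
def IsDualBaerModule (M : Type v) [AddCommGroup M] [Module R M] : Prop :=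
  ∀ N : Submodule R M, ∃ e : Module.End R M, IsIdempotentElem e ∧
    ∀ f : Module.End R M, (LinearMap.range f ≤ N) ↔ ∃ g : Module.End R M, f = e * g

/-- `M` satisfies the Schröder–Bernstein (SB) property: d-subisomorphic direct summands
of `M` are isomorphic. -/
def SatisfiesSB (M : Type v) [AddCommGroup M] [Module R M] : Prop :=
  ∀ A B : Submodule R M, IsDirectSummand R A → IsDirectSummand R B →
    DSubisomorphic R A B → Nonempty (A ≃ₗ[R] B)

/-- `N` is an essential submodule of `D` (inside the ambient module `M`). -/
def IsEssentialIn {M : Type v} [AddCommGroup M] [Module R M] (N D : Submodule R M) : Prop :=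
  N ≤ D ∧ ∀ L : Submodule R M, L ≤ D → L ⊓ N = ⊥ → L = ⊥

/-- A module is extending if every submodule is essential in a direct summand. -/
def IsExtendingModule (M : Type v) [AddCommGroup M] [Module R M] : Prop :=
  ∀ N : Submodule R M, ∃ D : Submodule R M, IsDirectSummand R D ∧ IsEssentialIn R N D

/-- An ideal of `R` is essential if it intersects every nonzero ideal nontrivially. -/
def IsEssentialIdeal (I : Submodule R R) : Prop :=
  ∀ J : Submodule R R, J ⊓ I = ⊥ → J = ⊥

/-- The annihilator of an element of a module, as an ideal of `R`. -/
def annihilatorOf {M : Type v} [AddCommGroup M] [Module R M] (m : M) : Submodule R R :=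
  LinearMap.ker (LinearMap.toSpanSingleton R M m)

/-- An element is singular if its annihilator is an essential ideal. -/
def IsSingularElem {M : Type v} [AddCommGroup M] [Module R M] (m : M) : Prop :=
  IsEssentialIdeal R (annihilatorOf R m)

/-- A module is singular if all of its elements are singular, i.e. `Z(M) = M`. -/
def IsSingularModule (M : Type v) [AddCommGroup M] [Module R M] : Prop :=
  ∀ m : M, IsSingularElem R m

/-- A module is nonsingular if only zero is singular, i.e. `Z(M) = 0`. -/
def IsNonsingularModule (M : Type v) [AddCommGroup M] [Module R M] : Prop :=
  ∀ m : M, IsSingularElem R m → m = 0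

/-- A subset of `R` is essential if it meets every nonzero ideal nontrivially. -/
def IsEssentialSet (A : Set R) : Prop :=
  ∀ J : Submodule R R, J ≠ ⊥ → ∃ x ∈ J, x ≠ 0 ∧ x ∈ A

/-- `m` belongs to the second singular submodule `Z₂(M)`: the annihilator of the image
of `m` in `M/Z(M)` is essential. -/
def IsZ2Elem {M : Type v} [AddCommGroup M] [Module R M] (m : M) : Prop :=
  IsEssentialSet R {r : R | IsSingularElem R (r • m)}

/-- The second singular ideal `Z₂(R)` of `R`, as a two-sided ideal. -/
def secondSingularIdeal : TwoSidedIdeal R :=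
  TwoSidedIdeal.span {r : R | IsZ2Elem R r}

/-- The quotient ring `R / Z₂(R)`. -/
def QuotBySecondSingular : Type u := (secondSingularIdeal R).ringCon.Quotient

noncomputable instance : Ring (QuotBySecondSingular R) :=
  inferInstanceAs (Ring (secondSingularIdeal R).ringCon.Quotient)

/-- `M` has finite uniform dimension: it contains no infinite direct sum of nonzero
submodules. -/
def HasFiniteUniformDim (M : Type v) [AddCommGroup M] [Module R M] : Prop :=
  ¬ ∃ f : ℕ → Submodule R M, (∀ n, f n ≠ ⊥) ∧ iSupIndep f

end Defs

section Aux

variable {R : Type u} [Ring R]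

lemma aux_ess_mono {I I' : Submodule R R} (hle : I ≤ I') (hI : IsEssentialIdeal R I) :
    IsEssentialIdeal R I' := fun J hJ =>
  hI J (le_bot_iff.1 (hJ ▸ inf_le_inf_left J hle))

/-- `X` is closed: the quotient by `X` is nonsingular. -/
def ZClosed {M : Type u} [AddCommGroup M] [Module R M] (X : Submodule R M) : Prop :=
  ∀ m : M, IsEssentialIdeal R (X.comap (LinearMap.toSpanSingleton R M m)) → m ∈ X

lemma aux_ess_comap {M : Type u} [AddCommGroup M] [Module R M] (X Y : Submodule R M)
    (hX : ∀ L : Submodule R M, L ≤ Y → L ⊓ X = ⊥ → L = ⊥) (m : M) (hm : m ∈ Y) :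
    IsEssentialIdeal R (X.comap (LinearMap.toSpanSingleton R M m)) := by
  intro J hJ
  have h1 : J.map (LinearMap.toSpanSingleton R M m) = ⊥ := by
    apply hX
    · rintro _ ⟨j, -, rfl⟩
      exact Y.smul_mem j hm
    · rw [eq_bot_iff]
      rintro _ ⟨⟨j, hj, rfl⟩, hx⟩
      have : j ∈ J ⊓ X.comap (LinearMap.toSpanSingleton R M m) := ⟨hj, hx⟩
      rw [hJ, Submodule.mem_bot] at this
      simp [this]
  rw [← hJ]
  refine le_antisymm (le_inf le_rfl fun j hj => ?_) inf_le_left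
  have : LinearMap.toSpanSingleton R M m j ∈ J.map (LinearMap.toSpanSingleton R M m) :=
    ⟨j, hj, rfl⟩
  rw [h1, Submodule.mem_bot] at this
  rw [Submodule.mem_comap, this]
  exact X.zero_mem

lemma aux_exists_compl {M : Type u} [AddCommGroup M] [Module R M] (X : Submodule R M) :
    ∃ Y : Submodule R M, Maximal (fun Y => Disjoint Y X) Y := by
  obtain ⟨Y, -, hY⟩ := zorn_le_nonempty₀ {Y : Submodule R M | Disjoint Y X} (by
    intro c hc hchain y hy
    refine ⟨sSup c, ?_, fun z hz => le_sSup hz⟩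
    show Disjoint (sSup c) X
    rw [Submodule.disjoint_def]
    intro x hx hxX
    rw [Submodule.mem_sSup_of_directed ⟨y, hy⟩ hchain.directedOn] at hx
    obtain ⟨z, hz, hxz⟩ := hx
    exact Submodule.disjoint_def.1 (hc hz) x hxz hxX) ⊥ disjoint_bot_left
  exact ⟨Y, hY⟩

/-- Closed submodules of injective modules are direct summands. -/
lemma aux_closed_proj {E : Type u} [AddCommGroup E] [Module R E] (hE : Module.Injective R E)
    (X : Submodule R E) (hX : ZClosed X) :
    ∃ p : E →ₗ[R] E, (∀ m, p m ∈ X) ∧ ∀ x ∈ X, p x = x := by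
  obtain ⟨Y, hY⟩ := aux_exists_compl X
  have hd : Disjoint Y X := hY.prop
  obtain ⟨h, hh⟩ := hE.out (X.subtype.coprod Y.subtype) (by
    rw [← LinearMap.ker_eq_bot, eq_bot_iff]
    rintro ⟨x, y⟩ hxy
    have hxy : (x : E) + y = 0 := by simpa using hxy
    have h1 : (x : E) = -y := eq_neg_of_add_eq_zero_left hxy
    have h2 : (x : E) = 0 :=
      Submodule.disjoint_def.1 hd x (h1 ▸ Y.neg_mem y.2) x.2
    have h3 : (y : E) = 0 := by simpa [h2] using hxy
    simp only [Submodule.mem_bot, Prod.mk_eq_zero]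
    exact ⟨Subtype.ext h2, Subtype.ext h3⟩) (X.subtype ∘ₗ LinearMap.fst R X Y)
  have hx : ∀ x ∈ X, h x = x := fun x hx => by simpa using hh (⟨x, hx⟩, 0)
  have hy : ∀ y ∈ Y, h y = 0 := fun y hy => by simpa using hh (0, ⟨y, hy⟩)
  refine ⟨h, fun m => hX _ (aux_ess_comap X (LinearMap.range h) ?_ _ ⟨m, rfl⟩), hx⟩
  intro L hL hLX
  have hle : L.comap h ≤ Y := hY.le_of_ge (y := L.comap h) (by
      rw [Submodule.disjoint_def]
      intro x hxL hxX
      have : x ∈ L ⊓ X := ⟨by simpa [hx x hxX] using hxL, hxX⟩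
      simpa [hLX] using this) (fun y hyY => by
        rw [Submodule.mem_comap, hy y hyY]; exact L.zero_mem)
  rw [eq_bot_iff]
  intro l hl
  obtain ⟨m, rfl⟩ := hL hl
  simpa using hy m (hle hl)

lemma aux_inj_retract {I E : Type u} [AddCommGroup I] [Module R I] [AddCommGroup E] [Module R E]
    (hI : Module.Injective R I) (s : E →ₗ[R] I) (q : I →ₗ[R] E) (hqs : ∀ x, q (s x) = x) :
    Module.Injective R E := by
  refine ⟨fun X Y _ _ _ _ f hf g => ?_⟩
  obtain ⟨h, hh⟩ := hI.out f hf (s ∘ₗ g)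
  exact ⟨q ∘ₗ h, fun x => by simp [hh, hqs]⟩

lemma aux_inj_embed (C : Type u) [AddCommGroup C] [Module R C] :
    ∃ (I : Type u) (_ : AddCommGroup I) (_ : Module R I) (i : C →ₗ[R] I),
      Module.Injective R I ∧ Function.Injective i := by
  obtain ⟨⟨J⟩⟩ := CategoryTheory.EnoughInjectives.presentation (ModuleCat.of R C)
  rename_i hJ f hf
  refine ⟨J, inferInstance, inferInstance, f.hom,
    Module.injective_module_of_injective_object R J, (ModuleCat.mono_iff_injective f).1 hf⟩

lemma aux_embed {C : Type u} [AddCommGroup C] [Module R C] (hC : IsNonsingularModule R C) :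
    ∃ (E : Type u) (_ : AddCommGroup E) (_ : Module R E) (i : C →ₗ[R] E),
      Module.Injective R E ∧ IsNonsingularModule R E ∧ Function.Injective i := by
  obtain ⟨I, _, _, i, hI, hi⟩ := aux_inj_embed (R := R) C
  obtain ⟨T, hT⟩ := aux_exists_compl (LinearMap.range i)
  have hd : Disjoint T (LinearMap.range i) := hT.prop
  have hTc : ZClosed T := by
    intro m hm
    have : T ⊔ Submodule.span R {m} ≤ T := hT.le_of_ge (y := T ⊔ Submodule.span R {m}) (by
      rw [Submodule.disjoint_def]
      rintro x hx ⟨c, rfl⟩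
      obtain ⟨t, ht, y, hy, hty⟩ := Submodule.mem_sup.1 hx
      obtain ⟨r, rfl⟩ := Submodule.mem_span_singleton.1 hy
      have hess : IsEssentialIdeal R
          ((T.comap (LinearMap.toSpanSingleton R I m)).comap (LinearMap.toSpanSingleton R R r)) :=
        aux_ess_comap _ ⊤ (fun L _ => hm L) r trivial
      have : c = 0 := hC c (aux_ess_mono (fun s hs => ?_) hess)
      · simp [this]
      · have hs : (s * r) • m ∈ T := by simpa using hs
        have h1 : s • i c ∈ T := by
          rw [← hty, smul_add, smul_smul]
          exact T.add_mem (T.smul_mem _ ht) hs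
        have h2 : s • i c = 0 :=
          Submodule.disjoint_def.1 hd _ h1 ⟨s • c, by simp⟩
        show s • c = 0
        apply hi
        simpa using h2) le_sup_left
    exact this (Submodule.mem_sup_right (Submodule.mem_span_singleton_self m))
  obtain ⟨p, hp, hpT⟩ := aux_closed_proj hI T hTc
  let q : I →ₗ[R] LinearMap.ker p := LinearMap.codRestrict _ (LinearMap.id - p)
    (fun m => by simp [hpT _ (hp m)])
  refine ⟨LinearMap.ker p, inferInstance, inferInstance, q ∘ₗ i,
    aux_inj_retract hI (LinearMap.ker p).subtype q ?_, ?_, ?_⟩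
  · rintro ⟨x, hx⟩
    apply Subtype.ext
    have hx : p x = 0 := hx
    simp [q, hx]
  · rintro ⟨x, hx⟩ hs
    have hx' : p x = 0 := hx
    have : x ∈ T := hTc x (aux_ess_mono (fun s hs => ?_) hs)
    · exact Subtype.ext ((hpT x this).symm.trans hx')
    · have h0 : s • (⟨x, hx⟩ : LinearMap.ker p) = 0 := hs
      have h1 : s • x = 0 := congrArg Subtype.val h0
      show s • x ∈ T
      rw [h1]; exact T.zero_mem
  · rw [← LinearMap.ker_eq_bot, eq_bot_iff]
    intro c hc
    have h0 : q (i c) = 0 := hc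
    have h1 : i c - p (i c) = 0 := congrArg Subtype.val h0
    have h2 : i c = p (i c) := sub_eq_zero.1 h1
    have h3 : i c = 0 := Submodule.disjoint_def.1 hd _ (h2 ▸ hp _) ⟨c, rfl⟩
    exact hi (by simpa using h3)

/-- A nonsingular module whose closed submodules split is Baer. -/
lemma aux_baer {M : Type u} [AddCommGroup M] [Module R M] (hM : IsNonsingularModule R M)
    (hs : ∀ X : Submodule R M, ZClosed X →
      ∃ p : M →ₗ[R] M, (∀ m, p m ∈ X) ∧ ∀ x ∈ X, p x = x) : IsBaerModule R M := by
  intro N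
  let X : Submodule R M :=
    ⨅ f : {f : Module.End R M // ∀ x ∈ N, f x = 0}, LinearMap.ker f.1
  have hXmem : ∀ m, m ∈ X ↔ ∀ f : Module.End R M, (∀ x ∈ N, f x = 0) → f m = 0 := by
    intro m
    simp [X, Submodule.mem_iInf]
  have hXc : ZClosed X := by
    intro m hm
    rw [hXmem]
    intro f hf
    refine hM _ (aux_ess_mono (fun s hs => ?_) hm)
    have h1 : s • m ∈ X := hs
    show s • f m = 0
    rw [← map_smul]
    exact (hXmem _).1 h1 f hf
  obtain ⟨p, hp, hpX⟩ := hs X hXc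
  refine ⟨1 - p, ?_, fun f => ⟨fun hf => ⟨f, ?_⟩, ?_⟩⟩
  · have : p * p = p := LinearMap.ext fun m => hpX _ (hp m)
    exact (IsIdempotentElem.one_sub this)
  · ext m
    simp [(hXmem _).1 (hp m) f hf]
  · rintro ⟨g, rfl⟩ x hx
    have : x ∈ X := (hXmem _).2 fun f hf => hf x hx
    simp [hpX x this]

lemma aux_prod_proj {K C : Type u} [AddCommGroup K] [Module R K] [AddCommGroup C] [Module R C]
    (hK : Module.Injective R K)
    (hC : ∀ A B : Submodule R C, A ⊓ B = ⊥ → A = ⊥ ∨ B = ⊥)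
    (X : Submodule R (K × C)) (hX : ZClosed X) :
    ∃ p : (K × C) →ₗ[R] (K × C), (∀ m, p m ∈ X) ∧ ∀ x ∈ X, p x = x := by
  obtain ⟨π, hπ, hπA⟩ := aux_closed_proj hK (X.comap (LinearMap.inl R K C)) (by
    intro k hk
    exact hX _ (aux_ess_mono (fun s hs => by simpa using hs) hk))
  have hπ' : ∀ k, (π k, (0 : C)) ∈ X := fun k => hπ k
  have hπA' : ∀ k, (k, (0 : C)) ∈ X → π k = k := fun k hk => hπA k hk
  let sx : X →ₗ[R] C := LinearMap.snd R K C ∘ₗ X.subtype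
  let fx : X →ₗ[R] K := (LinearMap.id - π) ∘ₗ LinearMap.fst R K C ∘ₗ X.subtype
  have hker : LinearMap.ker sx ≤ LinearMap.ker fx := by
    rintro ⟨⟨k, c⟩, hx⟩ hc
    have hc : c = 0 := hc
    subst hc
    simp [fx, hπA' k hx]
  obtain ⟨g, hg⟩ := hK.out ((LinearMap.ker sx).liftQ sx le_rfl)
    (by rw [← LinearMap.ker_eq_bot]; exact Submodule.ker_liftQ_eq_bot _ _ _ le_rfl)
    ((LinearMap.ker sx).liftQ fx hker)
  have hg : ∀ k c, (k, c) ∈ X → g c = k - π k := fun k c hx =>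
    hg (Submodule.Quotient.mk ⟨(k, c), hx⟩)
  by_cases hC' : X.map (LinearMap.snd R K C) = ⊥
  · have h0 : ∀ k c, (k, c) ∈ X → c = 0 := fun k c hx => by
      have : c ∈ X.map (LinearMap.snd R K C) := ⟨(k, c), hx, rfl⟩
      simpa [hC'] using this
    refine ⟨LinearMap.inl R K C ∘ₗ π ∘ₗ LinearMap.fst R K C, fun m => hπ' m.1, ?_⟩
    rintro ⟨k, c⟩ hx
    obtain rfl := h0 k c hx
    simp [hπA' k hx]
  · let g' : C →ₗ[R] K := (LinearMap.id - π) ∘ₗ g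
    have hππ : ∀ k, π (π k) = π k := fun k => hπA' _ (hπ' k)
    have hg' : ∀ k c, (k, c) ∈ X → g' c = k - π k := fun k c hx => by
      simp [g', hg k c hx, hππ]
    have hπg : ∀ c, π (g' c) = 0 := fun c => by simp [g', hππ]
    have hgX : ∀ c, (g' c, c) ∈ X := by
      intro c
      refine hX _ (aux_ess_mono (fun s hs => ?_)
        (aux_ess_comap (X.map (LinearMap.snd R K C)) ⊤
          (fun L _ hL => (hC _ _ hL).resolve_right hC') c trivial))
      obtain ⟨⟨k, c'⟩, hx, hcc⟩ := hs
      have hcc : c' = s • c := hcc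
      subst hcc
      have h2 := X.sub_mem hx (hπ' k)
      show s • (g' c, c) ∈ X
      have h3 : s • g' c = k - π k := by rw [← map_smul, hg' k _ hx]
      simpa [h3] using h2
    refine ⟨LinearMap.prod (π ∘ₗ LinearMap.fst R K C + g' ∘ₗ LinearMap.snd R K C)
      (LinearMap.snd R K C), fun m => ?_, ?_⟩
    · simpa using X.add_mem (hπ' m.1) (hgX m.2)
    · rintro ⟨k, c⟩ hx
      simp [hg' k c hx]

lemma aux_uniform_injective
    (h : ∀ (N : Type u) [AddCommGroup N] [Module R N]
        (K : Type u) [AddCommGroup K] [Module R K],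
        IsBaerModule R N → IsBaerModule R K →
        (∃ f : N →ₗ[R] K, Function.Injective f) →
        IsoToDirectSummand R K N →
        Nonempty (N ≃ₗ[R] K))
    (C : Type u) [AddCommGroup C] [Module R C] (hns : IsNonsingularModule R C)
    (hC : ∀ A B : Submodule R C, A ⊓ B = ⊥ → A = ⊥ ∨ B = ⊥) : Module.Injective R C := by
  obtain ⟨E, _, _, j, hE, hEns, hj⟩ := aux_embed hns
  have hK : Module.Injective R (ℕ → E) := by
    refine ⟨fun X Y _ _ _ _ f hf g => ?_⟩
    choose t ht using fun n : ℕ => hE.out f hf (LinearMap.proj n ∘ₗ g)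
    exact ⟨LinearMap.pi t, fun x => funext fun n => ht n x⟩
  have hKns : IsNonsingularModule R (ℕ → E) := by
    intro m hm
    funext n
    refine hEns _ (aux_ess_mono (fun s hs => ?_) hm)
    have hs : s • m = 0 := hs
    exact congrFun hs n
  have hNns : IsNonsingularModule R ((ℕ → E) × C) := by
    intro m hm
    refine Prod.ext (hKns _ (aux_ess_mono (fun s hs => ?_) hm))
      (hns _ (aux_ess_mono (fun s hs => ?_) hm))
    · have hs : s • m = 0 := hs
      exact congrArg Prod.fst hs
    · have hs : s • m = 0 := hs
      exact congrArg Prod.snd hs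
  obtain ⟨e⟩ := h ((ℕ → E) × C) (ℕ → E) (aux_baer hNns (aux_prod_proj hK hC))
    (aux_baer hKns (aux_closed_proj hK))
    ⟨LinearMap.pi (fun n => Nat.casesOn n (j ∘ₗ LinearMap.snd R (ℕ → E) C)
      (fun n => LinearMap.proj n ∘ₗ LinearMap.fst R (ℕ → E) C)), by
        rintro ⟨k, c⟩ ⟨k', c'⟩ hk
        have h0 : j c = j c' := congrFun hk 0
        refine Prod.ext (funext fun n => ?_) (hj h0)
        exact congrFun hk (n + 1)⟩
    ⟨LinearMap.range (LinearMap.inl R (ℕ → E) C), ⟨_, LinearMap.isCompl_range_inl_inr⟩,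
      ⟨LinearEquiv.ofInjective _ LinearMap.inl_injective⟩⟩
  exact aux_inj_retract hK (e.toLinearMap ∘ₗ LinearMap.inr R (ℕ → E) C)
    (LinearMap.snd R (ℕ → E) C ∘ₗ e.symm.toLinearMap) (by simp)

lemma aux_indep {f L : ℕ → Submodule R R} (hL : ∀ n, L (n + 1) ≤ L n) (hf : ∀ n, f n ≤ L n)
    (hd : ∀ n, Disjoint (f n) (L (n + 1))) : iSupIndep f := by
  classical
  have hanti : Antitone L := antitone_nat_of_succ_le hL
  rw [iSupIndep_iff_finsetSum_eq_zero_imp_eq_zero]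
  intro s v hv h0 i
  induction i using Nat.strong_induction_on with
  | _ i ih =>
    intro hi
    rw [← s.add_sum_erase _ hi] at h0
    have h1 : v i = - ∑ j ∈ s.erase i, v j := eq_neg_of_add_eq_zero_left h0
    refine Submodule.disjoint_def.1 (hd i) _ (hv i hi) ?_
    rw [h1]
    refine Submodule.neg_mem _ (Submodule.sum_mem _ fun j hj => ?_)
    obtain ⟨hji, hjs⟩ := Finset.mem_erase.1 hj
    rcases lt_or_gt_of_ne hji with hlt | hgt
    · rw [ih j hlt hjs]
      exact Submodule.zero_mem _
    · exact hanti hgt (hf j (hv j hjs))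

lemma aux_fd (hdim : HasFiniteUniformDim R R) (Q : Submodule R R → Prop)
    (hQ : ∀ L, Q L → ∃ A L' : Submodule R R, A ≠ ⊥ ∧ A ≤ L ∧ L' ≤ L ∧ Disjoint A L' ∧ Q L')
    (L : Submodule R R) : ¬ Q L := by
  intro hL
  choose A L' h1 h2 h3 h4 h5 using hQ
  let S : ℕ → {L // Q L} := fun n => Nat.rec ⟨L, hL⟩ (fun _ T => ⟨L' T.1 T.2, h5 T.1 T.2⟩) n
  exact hdim ⟨fun n => A (S n).1 (S n).2, fun n => h1 _ _,
    aux_indep (L := fun n => (S n).1) (fun n => h3 _ _) (fun n => h2 _ _) (fun n => h4 _ _)⟩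

def UnifIdeal (A : Submodule R R) : Prop :=
  A ≠ ⊥ ∧ ∀ B B' : Submodule R R, B ≤ A → B' ≤ A → B ⊓ B' = ⊥ → B = ⊥ ∨ B' = ⊥

lemma aux_exists_unif (hdim : HasFiniteUniformDim R R) (L : Submodule R R) (hL : L ≠ ⊥) :
    ∃ A ≤ L, UnifIdeal A := by
  by_contra hcon
  refine aux_fd hdim (fun L => L ≠ ⊥ ∧ ¬ ∃ A ≤ L, UnifIdeal A) ?_ L ⟨hL, hcon⟩
  rintro L ⟨h0, h1⟩
  have : ¬ UnifIdeal L := fun h => h1 ⟨L, le_rfl, h⟩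
  simp only [UnifIdeal, not_and, not_forall, not_or] at this
  obtain ⟨B, B', hB, hB', hd, hb, hb'⟩ := this h0
  exact ⟨B, B', hb, hB, hB', disjoint_iff.2 hd, hb', fun ⟨A, hA, hu⟩ => h1 ⟨A, hA.trans hB', hu⟩⟩

end Aux

/-- If `R` has finite uniform dimension as a module over itself, and any
pair of Baer `R`-modules `N`, `K` are isomorphic whenever `N` embeds in `K` and `K` is
isomorphic to a direct summand of `N`, then `R / Z₂(R)` is a semisimple Artinian ring. -/
theorem quot_secondSingular_semisimple_of_baer_SB
    (R : Type u) [Ring R]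
    (hdim : HasFiniteUniformDim R R)
    (h : ∀ (N : Type u) [AddCommGroup N] [Module R N]
        (K : Type u) [AddCommGroup K] [Module R K],
        IsBaerModule R N → IsBaerModule R K →
        (∃ f : N →ₗ[R] K, Function.Injective f) →
        IsoToDirectSummand R K N →
        Nonempty (N ≃ₗ[R] K)) :
    IsSemisimpleRing (QuotBySecondSingular R) := by
  -- nonsingular uniform left ideals are direct summands
  have hsum : ∀ A : Submodule R R, UnifIdeal A → (∀ x ∈ A, IsSingularElem R x → x = 0) →
      ∃ B, IsCompl A B := by
    intro A hA hns
    have hinj : Module.Injective R A := by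
      refine aux_uniform_injective h A ?_ ?_
      · rintro ⟨x, hx⟩ hs
        refine Subtype.ext (hns x hx (aux_ess_mono (fun s hs => ?_) hs))
        have hs : s • (⟨x, hx⟩ : A) = 0 := hs
        exact congrArg Subtype.val hs
      · intro B B' hBB
        have := hA.2 (B.map A.subtype) (B'.map A.subtype) (Submodule.map_subtype_le _ _)
          (Submodule.map_subtype_le _ _) (by
            rw [← Submodule.map_inf _ A.injective_subtype, hBB, Submodule.map_bot])
        have hb : ∀ B : Submodule R A, B.map A.subtype = ⊥ → B = ⊥ := fun B hB =>
          Submodule.map_injective_of_injective A.injective_subtype (by rw [hB, Submodule.map_bot])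
        exact this.imp (hb B) (hb B')
    obtain ⟨p, hp⟩ := hinj.out A.subtype A.injective_subtype LinearMap.id
    exact ⟨_, LinearMap.isCompl_of_proj (f := p) hp⟩
  have hatom : ∀ A : Submodule R R, UnifIdeal A → (∀ x ∈ A, IsSingularElem R x → x = 0) →
      IsAtom A := by
    intro A hA hns
    refine ⟨hA.1, fun B hB => ?_⟩
    by_contra hB0
    obtain ⟨B', hB'⟩ := hsum B ⟨hB0, fun C C' hC hC' => hA.2 C C' (hC.trans hB.le) (hC'.trans hB.le)⟩
      (fun x hx => hns x (hB.le hx))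
    have h1 : A ⊓ B' = ⊥ := (hA.2 B (A ⊓ B') hB.le inf_le_left (by
      rw [eq_bot_iff, ← hB'.inf_eq_bot]
      exact inf_le_inf_left _ inf_le_right)).resolve_left hB0
    have h2 : A = B := by
      calc A = A ⊓ (B ⊔ B') := by rw [hB'.sup_eq_top, inf_top_eq]
        _ = B ⊔ A ⊓ B' := by rw [inf_comm, sup_inf_assoc_of_le _ hB.le, inf_comm B']
        _ = B := by rw [h1, sup_bot_eq]
    exact hB.ne h2.symm
  -- a semisimple direct summand whose complement lies in `Z₂`
  have key : ∃ D T : Submodule R R, IsCompl D T ∧ IsSemisimpleModule R D ∧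
      ∀ t ∈ T, IsZ2Elem R t := by
    by_contra hcon
    refine aux_fd hdim (fun T => ∃ D, IsCompl D T ∧ IsSemisimpleModule R D) ?_ ⊤
      ⟨⊥, isCompl_bot_top, @IsSemisimpleModule.mk _ _ _ _ _ ⟨fun a => ⟨⊤, isCompl_iff.2
        ⟨disjoint_iff.2 (Subsingleton.elim _ _), codisjoint_iff.2 (Subsingleton.elim _ _)⟩⟩⟩⟩
    rintro T ⟨D, hDT, hD⟩
    have hT : ∃ A ≤ T, UnifIdeal A ∧ ∀ x ∈ A, IsSingularElem R x → x = 0 := by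
      by_contra hno
      refine hcon ⟨D, T, hDT, hD, fun t ht J hJ => ?_⟩
      by_contra hJt
      have hJt' : ∀ x ∈ J, IsSingularElem R (x • t) → x = 0 := fun x hx hs => by
        by_contra hx0
        exact hJt ⟨x, hx, hx0, hs⟩
      have hne : J.map (LinearMap.toSpanSingleton R R t) ≠ ⊥ := by
        intro h0
        apply hJ
        rw [eq_bot_iff]
        intro x hx
        have h1 : LinearMap.toSpanSingleton R R t x ∈ J.map (LinearMap.toSpanSingleton R R t) :=
          ⟨x, hx, rfl⟩
        rw [h0, Submodule.mem_bot] at h1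
        have h1 : x • t = 0 := h1
        refine hJt' x hx ?_
        rw [h1]
        intro L hL
        rw [← hL]
        refine le_antisymm (le_inf le_rfl fun y _ => ?_) inf_le_left
        show y • (0 : R) = 0
        simp
      obtain ⟨A, hA, hu⟩ := aux_exists_unif hdim _ hne
      refine hno ⟨A, hA.trans ?_, hu, fun x hx hs => ?_⟩
      · rintro _ ⟨x, -, rfl⟩
        exact T.smul_mem x ht
      · obtain ⟨y, hy, rfl⟩ := hA hx
        rw [hJt' y hy hs, map_zero]
    obtain ⟨A, hAT, hu, hns⟩ := hT
    obtain ⟨B, hAB⟩ := hsum A hu hns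
    have hAs : IsSimpleModule R A := isSimpleModule_iff_isAtom.2 (hatom A hu hns)
    have hT' : A ⊔ B ⊓ T = T := by
      rw [← sup_inf_assoc_of_le _ hAT, hAB.sup_eq_top, top_inf_eq]
    have hd : Disjoint A (B ⊓ T) := hAB.disjoint.mono_right inf_le_left
    refine ⟨A, B ⊓ T, hu.1, hAT, inf_le_right, hd, D ⊔ A,
      hd.isCompl_sup_left_of_isCompl_sup_right (hT'.symm ▸ hDT),
      IsSemisimpleModule.sup hD inferInstance⟩
  obtain ⟨D, T, hDT, hD, hT⟩ := key
  let φ : R →+* QuotBySecondSingular R := (secondSingularIdeal R).ringCon.mk'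
  have hφ : Function.Surjective φ := Quotient.mk''_surjective
  have hφT : ∀ t ∈ T, φ t = 0 := fun t ht => by
    have h1 : t ∈ secondSingularIdeal R := TwoSidedIdeal.subset_span (hT t ht)
    exact Quotient.sound ((TwoSidedIdeal.mem_iff _ _).1 h1)
  letI : Module R (QuotBySecondSingular R) := Module.compHom _ φ
  let ψ : R →ₗ[R] QuotBySecondSingular R :=
    { toFun := φ, map_add' := map_add φ, map_smul' := fun r x => map_mul φ r x }
  have hss : IsSemisimpleModule R (QuotBySecondSingular R) := by
    refine IsSemisimpleModule.of_surjective (ψ ∘ₗ D.subtype) fun y => ?_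
    obtain ⟨x, rfl⟩ := hφ y
    have hx : x ∈ D ⊔ T := by rw [hDT.sup_eq_top]; trivial
    obtain ⟨d, hd, t, ht, rfl⟩ := Submodule.mem_sup.1 hx
    refine ⟨⟨d, hd⟩, ?_⟩
    show φ d = φ (d + t)
    rw [map_add, hφT t ht, add_zero]
  haveI : RingHomSurjective φ := ⟨hφ⟩
  let l : QuotBySecondSingular R →ₛₗ[φ] QuotBySecondSingular R :=
    { toFun := id, map_add' := fun _ _ => rfl, map_smul' := fun _ _ => rfl }
  exact (l.isSemisimpleModule_iff_of_bijective Function.bijective_id).1 hss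
end

section
/- Let R be a ring. The following statements are equivalent: (a) for any right R-module Y and any nonsingular extending right R-module X, if X and Y are subisomorphic to each other then X ≅ Y; (b) any pair of nonsingular right R-modules that are subisomorphic to each other are isomorphic; (c) R/Z₂(R) is a semisimple Artinian ring, where Z₂(R) denotes the second singular submodule of the right R-module R. -/
universe u v

section Helpers

variable {R : Type u} [Ring R]

theorem annihilatorOf_mem {M : Type v} [AddCommGroup M] [Module R M] (m : M) (r : R) :
    r ∈ annihilatorOf R m ↔ r • m = 0 := by
  simp [annihilatorOf]

theorem isSingularElem_iff {M : Type v} [AddCommGroup M] [Module R M] (m : M) :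
    IsSingularElem R m ↔ ∀ a : R, a ≠ 0 → ∃ s : R, s * a ≠ 0 ∧ (s * a) • m = 0 := by
  constructor
  · intro h a ha
    by_contra! hc
    apply ha
    have := h (Submodule.span R {a}) (by
      rw [eq_bot_iff]
      rintro x ⟨hx1, hx2⟩
      obtain ⟨s, rfl⟩ := Submodule.mem_span_singleton.1 hx1
      have h2 := (annihilatorOf_mem m _).1 hx2
      by_contra h3
      exact hc s h3 h2)
    simpa using this
  · intro h J hJ
    rw [eq_bot_iff]
    intro a ha
    by_contra h0
    obtain ⟨s, hs, hs2⟩ := h a h0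
    have : s * a ∈ J ⊓ annihilatorOf R m :=
      ⟨J.smul_mem s ha, (annihilatorOf_mem m _).2 hs2⟩
    rw [hJ] at this
    exact hs this

theorem isZ2Elem_iff {M : Type v} [AddCommGroup M] [Module R M] (m : M) :
    IsZ2Elem R m ↔ ∀ a : R, a ≠ 0 → ∃ s : R, s * a ≠ 0 ∧ IsSingularElem R ((s * a) • m) := by
  constructor
  · intro h a ha
    obtain ⟨x, hx, hx0, hx2⟩ := h (Submodule.span R {a}) (by simpa using ha)
    obtain ⟨s, rfl⟩ := Submodule.mem_span_singleton.1 hx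
    exact ⟨s, hx0, hx2⟩
  · intro h J hJ
    obtain ⟨a, ha, ha0⟩ := (Submodule.ne_bot_iff _).1 hJ
    obtain ⟨s, hs, hs2⟩ := h a ha0
    exact ⟨s * a, J.smul_mem s ha, hs, hs2⟩

section sing
variable {M : Type v} [AddCommGroup M] [Module R M]

theorem sing_zero : IsSingularElem R (0 : M) := by
  rw [isSingularElem_iff]
  intro a ha
  exact ⟨1, by simpa using ha, by simp⟩

theorem sing_add {m n : M} (hm : IsSingularElem R m) (hn : IsSingularElem R n) :
    IsSingularElem R (m + n) := by
  rw [isSingularElem_iff] at *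
  intro a ha
  obtain ⟨s, hs, hs2⟩ := hm a ha
  obtain ⟨t, ht, ht2⟩ := hn _ hs
  refine ⟨t * s, by rwa [mul_assoc], ?_⟩
  rw [mul_assoc, smul_add, ht2, mul_smul, hs2]
  simp

theorem sing_smul {m : M} (b : R) (hm : IsSingularElem R m) :
    IsSingularElem R (b • m) := by
  rw [isSingularElem_iff] at *
  intro a ha
  by_cases h : a * b = 0
  · exact ⟨1, by simpa using ha, by rw [one_mul, ← mul_smul, h, zero_smul]⟩
  · obtain ⟨s, hs, hs2⟩ := hm _ h
    refine ⟨s, fun h0 => hs (by rw [← mul_assoc, h0, zero_mul]), ?_⟩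
    rw [← mul_smul, mul_assoc, hs2]

theorem sing_map {N : Type*} [AddCommGroup N] [Module R N] (f : M →ₗ[R] N) {m : M}
    (hm : IsSingularElem R m) : IsSingularElem R (f m) := by
  rw [isSingularElem_iff] at *
  intro a ha
  obtain ⟨s, hs, hs2⟩ := hm a ha
  exact ⟨s, hs, by rw [← map_smul, hs2, map_zero]⟩

theorem sing_of_map {N : Type*} [AddCommGroup N] [Module R N] (f : M →ₗ[R] N)
    (hf : Function.Injective f) {m : M}
    (hm : IsSingularElem R (f m)) : IsSingularElem R m := by
  rw [isSingularElem_iff] at *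
  intro a ha
  obtain ⟨s, hs, hs2⟩ := hm a ha
  exact ⟨s, hs, hf (by rw [map_smul, hs2, map_zero])⟩

theorem nonsing_of_inj {N : Type*} [AddCommGroup N] [Module R N] (f : M →ₗ[R] N)
    (hf : Function.Injective f) (hN : IsNonsingularModule R N) : IsNonsingularModule R M :=
  fun m hm => hf (by rw [hN _ (sing_map f hm), map_zero])

theorem z2_add {m n : M} (hm : IsZ2Elem R m) (hn : IsZ2Elem R n) : IsZ2Elem R (m + n) := by
  rw [isZ2Elem_iff] at *
  intro a ha
  obtain ⟨s, hs, hs2⟩ := hm a ha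
  obtain ⟨t, ht, ht2⟩ := hn _ hs
  refine ⟨t * s, by rwa [mul_assoc], ?_⟩
  rw [mul_assoc, smul_add]
  refine sing_add ?_ ht2
  rw [mul_smul]
  exact sing_smul _ hs2

theorem z2_zero : IsZ2Elem R (0 : M) := by
  rw [isZ2Elem_iff]
  intro a ha
  exact ⟨1, by simpa using ha, by simpa using sing_zero⟩

theorem z2_smul {m : M} (b : R) (hm : IsZ2Elem R m) : IsZ2Elem R (b • m) := by
  rw [isZ2Elem_iff] at *
  intro a ha
  by_cases h : a * b = 0
  · refine ⟨1, by simpa using ha, ?_⟩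
    rw [one_mul, ← mul_smul, h, zero_smul]
    exact sing_zero
  · obtain ⟨s, hs, hs2⟩ := hm _ h
    refine ⟨s, fun h0 => hs (by rw [← mul_assoc, h0, zero_mul]), ?_⟩
    rw [← mul_smul, mul_assoc]
    exact hs2

theorem z2_map {N : Type*} [AddCommGroup N] [Module R N] (f : M →ₗ[R] N) {m : M}
    (hm : IsZ2Elem R m) : IsZ2Elem R (f m) := by
  rw [isZ2Elem_iff] at *
  intro a ha
  obtain ⟨s, hs, hs2⟩ := hm a ha
  exact ⟨s, hs, by rw [← map_smul]; exact sing_map f hs2⟩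

theorem z2_eq_zero (hM : IsNonsingularModule R M) {m : M} (hm : IsZ2Elem R m) : m = 0 := by
  apply hM
  rw [isZ2Elem_iff] at hm
  rw [isSingularElem_iff]
  intro a ha
  obtain ⟨s, hs, hs2⟩ := hm a ha
  exact ⟨s, hs, hM _ hs2⟩

end sing

theorem mem_secondSingular (x : R) : x ∈ secondSingularIdeal R ↔ IsZ2Elem R x := by
  constructor
  · intro h
    have h' := TwoSidedIdeal.mem_span_iff.1 h
      (TwoSidedIdeal.mk' {r : R | IsZ2Elem R r} z2_zero (fun h1 h2 => z2_add h1 h2)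
        (fun {x} h1 => by
          have := z2_smul (-1 : R) h1
          simpa using this)
        (fun {x y} h1 => z2_smul x h1)
        (fun {x y} h1 => z2_map (LinearMap.toSpanSingleton R R y) h1))
      (by
        intro r hr
        exact (TwoSidedIdeal.mem_mk' _ _ _ _ _ _ _).2 hr)
    exact (TwoSidedIdeal.mem_mk' _ _ _ _ _ _ _).1 h'
  · intro h
    exact TwoSidedIdeal.subset_span h

/-- The second singular ideal as a left ideal. -/
def zIdeal (R : Type u) [Ring R] : Submodule R R := (secondSingularIdeal R).asIdeal

theorem mem_zIdeal (x : R) : x ∈ zIdeal R ↔ IsZ2Elem R x := by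
  rw [← mem_secondSingular]
  exact TwoSidedIdeal.mem_asIdeal

theorem nonsing_quot : IsNonsingularModule R (R ⧸ zIdeal R) := by
  intro m hm
  obtain ⟨x, rfl⟩ := Submodule.Quotient.mk_surjective _ m
  rw [Submodule.Quotient.mk_eq_zero, mem_zIdeal, isZ2Elem_iff]
  rw [isSingularElem_iff] at hm
  intro a ha
  obtain ⟨s, hs, hs2⟩ := hm a ha
  rw [← Submodule.Quotient.mk_smul, Submodule.Quotient.mk_eq_zero, mem_zIdeal,
    isZ2Elem_iff] at hs2
  by_cases h : ∃ t : R, t * (s * a) ≠ 0 ∧ IsSingularElem R (t • ((s * a) • x))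
  · obtain ⟨t, ht, ht2⟩ := h
    refine ⟨t * s, by rwa [mul_assoc], ?_⟩
    rwa [mul_assoc, mul_smul]
  · push Not at h
    refine ⟨s, hs, ?_⟩
    have : IsSingularElem R (s * a) := by
      rw [isSingularElem_iff]
      intro b hb
      obtain ⟨t, ht, ht2⟩ := hs2 b hb
      refine ⟨t, ht, ?_⟩
      by_contra h0
      exact h _ h0 ht2
    exact sing_map (LinearMap.toSpanSingleton R R x) this

theorem semisimple_iff :
    IsSemisimpleRing (QuotBySecondSingular R) ↔ IsSemisimpleModule R (R ⧸ zIdeal R) := by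
  let σ : R →+* QuotBySecondSingular R := (secondSingularIdeal R).ringCon.mk'
  have hσ : Function.Surjective σ := RingCon.mk'_surjective _
  have hk : ∀ x, σ x = 0 ↔ x ∈ zIdeal R := by
    intro x
    have : σ x = σ 0 ↔ (secondSingularIdeal R).ringCon x 0 := RingCon.eq _
    rw [map_zero] at this
    rw [this]
    rfl
  have : RingHomSurjective σ := ⟨hσ⟩
  let f : R →ₛₗ[σ] QuotBySecondSingular R :=
    { toFun := σ, map_add' := map_add σ, map_smul' := fun a b => map_mul σ a b }
  let l := (zIdeal R).liftQ f (fun x hx => (hk x).2 hx)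
  have hl : Function.Bijective l := by
    constructor
    · rw [injective_iff_map_eq_zero]
      intro q
      obtain ⟨x, rfl⟩ := Submodule.Quotient.mk_surjective _ q
      intro h
      rw [Submodule.Quotient.mk_eq_zero]
      exact (hk x).1 h
    · intro y
      obtain ⟨x, rfl⟩ := hσ y
      exact ⟨Submodule.Quotient.mk x, rfl⟩
  exact (LinearMap.isSemisimpleModule_iff_of_bijective (l := l) hl).symm

theorem semisimple_of_nonsing (hR : IsSemisimpleModule R (R ⧸ zIdeal R))
    {X : Type*} [AddCommGroup X] [Module R X] (hX : IsNonsingularModule R X) :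
    IsSemisimpleModule R X := by
  let φ : X → ((R ⧸ zIdeal R) →ₗ[R] X) := fun x =>
    (zIdeal R).liftQ (LinearMap.toSpanSingleton R X x) (fun z hz =>
      z2_eq_zero hX (z2_map (LinearMap.toSpanSingleton R X x) ((mem_zIdeal z).1 hz)))
  refine isSemisimpleModule_of_isSemisimpleModule_submodule'
    (p := fun x => LinearMap.range (φ x)) (fun x => IsSemisimpleModule.range _) ?_
  rw [eq_top_iff]
  intro x _
  refine Submodule.mem_iSup_of_mem x ⟨Submodule.Quotient.mk 1, ?_⟩
  exact one_smul R x

theorem semisimple_SB {X : Type*} [AddCommGroup X] [Module R X]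
    {Y : Type*} [AddCommGroup Y] [Module R Y] (hX : IsSemisimpleModule R X)
    (f : X →ₗ[R] Y) (hf : Function.Injective f) (g : Y →ₗ[R] X) (hg : Function.Injective g) :
    Nonempty (X ≃ₗ[R] Y) := by
  let h : X →ₗ[R] X := g ∘ₗ f
  have hh : Function.Injective h := hg.comp hf
  obtain ⟨A, hA⟩ := exists_isCompl (LinearMap.range g)
  let F : Submodule R X →o Submodule R X :=
    ⟨fun P => A ⊔ P.map h, fun P Q hPQ => sup_le_sup_left (Submodule.map_mono hPQ) _⟩
  let P := OrderHom.lfp F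
  have hP : A ⊔ P.map h = P := OrderHom.map_lfp F
  obtain ⟨K, hK⟩ := exists_isCompl (P.map h)
  have hPg : P.map h ≤ LinearMap.range g := by
    rintro _ ⟨p, -, rfl⟩
    exact ⟨f p, rfl⟩
  let C := K ⊓ LinearMap.range g
  have hC : P.map h ⊔ C = LinearMap.range g := by
    change P.map h ⊔ K ⊓ LinearMap.range g = _
    rw [← sup_inf_assoc_of_le K hPg, hK.sup_eq_top, top_inf_eq]
  have hPC : IsCompl P C := by
    constructor
    · rw [Submodule.disjoint_def]
      intro x hxP hxC
      rw [← hP] at hxP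
      obtain ⟨a, ha, b, hb, rfl⟩ := Submodule.mem_sup.1 hxP
      have ha2 : a ∈ LinearMap.range g := by
        have := Submodule.sub_mem _ hxC.2 (hPg hb)
        simpa using this
      have ha0 : a = 0 := (Submodule.disjoint_def.1 hA.disjoint) a ha2 ha
      subst ha0
      rw [zero_add] at hxC ⊢
      exact (Submodule.disjoint_def.1 hK.disjoint) b hb hxC.1
    · rw [codisjoint_iff, ← hP, sup_assoc, hC, sup_comm, hA.sup_eq_top]
  let φ : (P × C) →ₗ[R] X := (h ∘ₗ P.subtype).coprod C.subtype
  have hφ : Function.Injective φ := by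
    rw [injective_iff_map_eq_zero]
    rintro ⟨p, c⟩ hpc
    have e : h p + (c : X) = 0 := by simpa [φ] using hpc
    have hc : (c : X) = h (-p) := by
      rw [map_neg]; exact eq_neg_of_add_eq_zero_right e
    have hc0 : (c : X) = 0 := by
      refine (Submodule.disjoint_def.1 hK.disjoint) c ?_ c.2.1
      rw [hc]
      exact ⟨-p, P.neg_mem p.2, rfl⟩
    have hp0 : (p : X) = 0 := hh (by simpa [hc0] using e)
    ext
    · exact hp0
    · exact hc0
  have hr : LinearMap.range φ = LinearMap.range g := by
    rw [LinearMap.range_coprod, LinearMap.range_comp, Submodule.range_subtype,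
      Submodule.range_subtype, hC]
  exact ⟨(Submodule.prodEquivOfIsCompl P C hPC).symm ≪≫ₗ LinearEquiv.ofInjective φ hφ ≪≫ₗ
    LinearEquiv.ofEq _ _ hr ≪≫ₗ (LinearEquiv.ofInjective g hg).symm⟩

theorem isEssentialIn_iff {M : Type v} [AddCommGroup M] [Module R M] (N D : Submodule R M) :
    IsEssentialIn R N D ↔ N ≤ D ∧ ∀ x ∈ D, x ≠ 0 → ∃ r : R, r • x ≠ 0 ∧ r • x ∈ N := by
  refine and_congr_right fun hND => ⟨?_, ?_⟩
  · intro h x hx hx0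
    by_contra! hc
    apply hx0
    have := h (Submodule.span R {x}) (by simpa using hx) (by
      rw [eq_bot_iff]
      rintro y ⟨hy1, hy2⟩
      obtain ⟨s, rfl⟩ := Submodule.mem_span_singleton.1 hy1
      by_contra h3
      exact hc s h3 hy2)
    simpa using this
  · intro h L hL hLN
    rw [eq_bot_iff]
    intro x hx
    by_contra hx0
    obtain ⟨r, hr, hr2⟩ := h x (hL hx) hx0
    have : r • x ∈ L ⊓ N := ⟨L.smul_mem r hx, hr2⟩
    rw [hLN] at this
    exact hr this

theorem extending_of_injective {I : Type u} [AddCommGroup I] [Module R I]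
    [Module.Injective R I] : IsExtendingModule R I := by
  intro N
  obtain ⟨D, hND, hD⟩ := zorn_le_nonempty₀ {D : Submodule R I | IsEssentialIn R N D} (by
    intro c hc hchain y hy
    refine ⟨sSup c, ?_, fun z hz => le_sSup hz⟩
    rw [Set.mem_ofPred_eq, isEssentialIn_iff]
    refine ⟨(hc hy).1.trans (le_sSup hy), ?_⟩
    intro x hx
    obtain ⟨z, hz, hxz⟩ := (Submodule.mem_sSup_of_directed ⟨y, hy⟩ hchain.directedOn).1 hx
    exact ((isEssentialIn_iff _ _).1 (hc hz)).2 x hxz) N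
      ((isEssentialIn_iff _ _).2 ⟨le_rfl, fun x hx h0 => ⟨1, by simpa using h0, by simpa using hx⟩⟩)
  have hDe := (isEssentialIn_iff _ _).1 hD.prop
  obtain ⟨K, -, hK⟩ := zorn_le_nonempty₀ {K : Submodule R I | ∀ x ∈ K, x ∈ D → x = 0} (by
    intro c hc hchain y hy
    refine ⟨sSup c, ?_, fun z hz => le_sSup hz⟩
    intro x hx hxD
    obtain ⟨z, hz, hxz⟩ := (Submodule.mem_sSup_of_directed ⟨y, hy⟩ hchain.directedOn).1 hx
    exact hc hz x hxz hxD) ⊥ (by intro x hx _; simpa using hx)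
  have hKD : ∀ x ∈ K, x ∈ D → x = 0 := hK.prop
  have hess : ∀ q : I ⧸ K, q ≠ 0 → ∃ r : R, ∃ d ∈ D, d ≠ 0 ∧ r • q = Submodule.Quotient.mk d := by
    intro q hq
    obtain ⟨y, rfl⟩ := Submodule.Quotient.mk_surjective _ q
    by_contra! hc
    apply hq
    rw [Submodule.Quotient.mk_eq_zero]
    have hle : K ⊔ Submodule.span R {y} ≤ K := by
      refine hK.le_of_ge ?_ le_sup_left
      intro x hx hxD
      obtain ⟨k, hk, z, hz, rfl⟩ := Submodule.mem_sup.1 hx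
      obtain ⟨r, rfl⟩ := Submodule.mem_span_singleton.1 hz
      by_contra h0
      refine hc r _ hxD h0 ?_
      rw [← Submodule.Quotient.mk_smul, Submodule.Quotient.eq]
      simpa using hk
    exact hle (Submodule.mem_sup_right (Submodule.mem_span_singleton_self y))
  obtain ⟨h, hh⟩ := Module.Injective.out (K.mkQ ∘ₗ D.subtype) (by
    rw [injective_iff_map_eq_zero]
    rintro ⟨d, hd⟩ h0
    have : d ∈ K := by simpa using h0
    exact Subtype.ext (hKD d this hd)) D.subtype
  have hh' : ∀ d ∈ D, h (Submodule.Quotient.mk d) = d := fun d hd => hh ⟨d, hd⟩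
  have hinj : ∀ q, h q = 0 → q = 0 := by
    intro q hq
    by_contra h0
    obtain ⟨r, d, hd, hd0, e⟩ := hess q h0
    apply hd0
    rw [← hh' d hd, ← e, map_smul, hq, smul_zero]
  have hrange : LinearMap.range h ≤ D := by
    have hDr : D ≤ LinearMap.range h := fun d hd => ⟨_, hh' d hd⟩
    refine hD.le_of_ge ((isEssentialIn_iff _ _).2 ⟨hDe.1.trans hDr, ?_⟩) hDr
    rintro _ ⟨q, rfl⟩ hq
    obtain ⟨r, d, hd, hd0, e⟩ := hess q (fun h0 => hq (by rw [h0, map_zero]))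
    obtain ⟨s, hs, hs2⟩ := hDe.2 d hd hd0
    have e2 : (s * r) • h q = s • d := by
      rw [mul_smul, ← map_smul, e, hh' d hd]
    exact ⟨s * r, by rwa [e2], by rwa [e2]⟩
  refine ⟨D, ⟨K, ?_⟩, hD.prop⟩
  constructor
  · rw [Submodule.disjoint_def]
    exact fun x hx hxK => hKD x hxK hx
  · rw [codisjoint_iff, eq_top_iff]
    intro y _
    have hd : h (Submodule.Quotient.mk y) ∈ D := hrange ⟨_, rfl⟩
    have := hinj (Submodule.Quotient.mk (y - h (Submodule.Quotient.mk y))) (by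
      rw [Submodule.Quotient.mk_sub, map_sub, hh' _ hd, sub_self])
    rw [Submodule.Quotient.mk_eq_zero] at this
    have := Submodule.add_mem_sup hd this
    simpa using this

theorem injective_of_retract {M E : Type u} [AddCommGroup M] [Module R M]
    [AddCommGroup E] [Module R E] [Module.Injective R E] (i : M →ₗ[R] E) (p : E →ₗ[R] M)
    (hpi : ∀ m, p (i m) = m) : Module.Injective R M where
  out X Y _ _ _ _ f hf g := by
    obtain ⟨h, hh⟩ := Module.Injective.out f hf (i ∘ₗ g)
    exact ⟨p ∘ₗ h, fun x => by simp [hh, hpi]⟩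

theorem exists_hull {M : Type u} [AddCommGroup M] [Module R M] (hM : IsNonsingularModule R M) :
    ∃ (E : Type u) (_ : AddCommGroup E) (_ : Module R E) (i : M →ₗ[R] E),
      Module.Injective R E ∧ IsNonsingularModule R E ∧ Function.Injective i := by
  obtain ⟨J, hJ, f, hf⟩ := CategoryTheory.EnoughInjectives.presentation (ModuleCat.of R M)
  have : Module.Injective R J := Module.injective_module_of_injective_object R J
  have hf' : Function.Injective f.hom := (ModuleCat.mono_iff_injective f).1 hf
  let j : M →ₗ[R] J := f.hom
  obtain ⟨D, ⟨K, hDK⟩, hD⟩ := extending_of_injective (R := R) (I := J) (LinearMap.range j)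
  rw [isEssentialIn_iff] at hD
  refine ⟨D, inferInstance, inferInstance, j.codRestrict D (fun m => hD.1 ⟨m, rfl⟩), ?_, ?_, ?_⟩
  · exact injective_of_retract D.subtype (D.projectionOnto K hDK)
      (fun m => by simp)
  · intro d hd
    by_contra h0
    obtain ⟨r, hr, m, hm⟩ := hD.2 d d.2 (by simpa using h0)
    have h1 : IsSingularElem R (j m) := by
      rw [hm]
      exact sing_smul r (sing_map D.subtype hd)
    have := hM m (sing_of_map j hf' h1)
    rw [this, map_zero] at hm
    exact hr hm.symm
  · intro a b hab
    exact hf' (congrArg Subtype.val hab)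

theorem injective_of_a (ha : ∀ (X : Type u) [AddCommGroup X] [Module R X]
        (Y : Type u) [AddCommGroup Y] [Module R Y],
        IsNonsingularModule R X → IsExtendingModule R X →
        Subisomorphic R X Y → Nonempty (X ≃ₗ[R] Y))
    {M : Type u} [AddCommGroup M] [Module R M] (hM : IsNonsingularModule R M) :
    Module.Injective R M := by
  obtain ⟨E, _, _, i, hE, hEn, hi⟩ := exists_hull hM
  have hXn : IsNonsingularModule R (ℕ → E) := fun x hx =>
    funext fun n => hEn _ (sing_map (LinearMap.proj (R := R) (φ := fun _ : ℕ => E) n) hx)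
  let g : (M × (ℕ → E)) →ₗ[R] (ℕ → E) :=
    { toFun := fun p n => Nat.casesOn n (i p.1) p.2
      map_add' := by
        intro p q
        funext n
        cases n <;> simp
      map_smul' := by
        intro r p
        funext n
        cases n <;> simp }
  have hg : Function.Injective g := by
    rintro ⟨m, x⟩ ⟨m', x'⟩ e
    have e0 : i m = i m' := congrFun e 0
    have e1 : x = x' := funext fun n => congrFun e (n + 1)
    rw [hi e0, e1]
  obtain ⟨e⟩ := ha (ℕ → E) (M × (ℕ → E)) hXn extending_of_injective
    ⟨⟨LinearMap.inr R M (ℕ → E), LinearMap.inr_injective⟩, g, hg⟩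
  exact injective_of_retract (e.symm.toLinearMap ∘ₗ LinearMap.inl R M (ℕ → E))
    (LinearMap.fst R M (ℕ → E) ∘ₗ e.toLinearMap) (fun m => by simp)

theorem c_of_a (ha : ∀ (X : Type u) [AddCommGroup X] [Module R X]
        (Y : Type u) [AddCommGroup Y] [Module R Y],
        IsNonsingularModule R X → IsExtendingModule R X →
        Subisomorphic R X Y → Nonempty (X ≃ₗ[R] Y)) :
    IsSemisimpleRing (QuotBySecondSingular R) := by
  rw [semisimple_iff, isSemisimpleModule_iff]
  refine ⟨fun N => ?_⟩
  have : Module.Injective R N :=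
    injective_of_a ha (nonsing_of_inj N.subtype N.injective_subtype nonsing_quot)
  obtain ⟨h, hh⟩ := Module.Injective.out N.subtype N.injective_subtype
    (LinearMap.id : N →ₗ[R] N)
  exact ⟨LinearMap.ker h, LinearMap.isCompl_of_proj hh⟩

end Helpers

/-- The following are equivalent:
(a) for any `R`-module `Y` and any nonsingular extending `R`-module `X`, if `X` and `Y`
    are mutually subisomorphic then `X ≅ Y`;
(b) any pair of mutually subisomorphic nonsingular `R`-modules are isomorphic;
(c) `R / Z₂(R)` is a semisimple Artinian ring. -/
theorem nonsingular_SB_iff_quot_secondSingular_semisimple (R : Type u) [Ring R] :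
    ((∀ (X : Type u) [AddCommGroup X] [Module R X]
        (Y : Type u) [AddCommGroup Y] [Module R Y],
        IsNonsingularModule R X → IsExtendingModule R X →
        Subisomorphic R X Y → Nonempty (X ≃ₗ[R] Y)) ↔
      (∀ (X : Type u) [AddCommGroup X] [Module R X]
        (Y : Type u) [AddCommGroup Y] [Module R Y],
        IsNonsingularModule R X → IsNonsingularModule R Y →
        Subisomorphic R X Y → Nonempty (X ≃ₗ[R] Y))) ∧
    ((∀ (X : Type u) [AddCommGroup X] [Module R X]
        (Y : Type u) [AddCommGroup Y] [Module R Y],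
        IsNonsingularModule R X → IsNonsingularModule R Y →
        Subisomorphic R X Y → Nonempty (X ≃ₗ[R] Y)) ↔
      IsSemisimpleRing (QuotBySecondSingular R)) := by
  have ba : (∀ (X : Type u) [AddCommGroup X] [Module R X]
        (Y : Type u) [AddCommGroup Y] [Module R Y],
        IsNonsingularModule R X → IsNonsingularModule R Y →
        Subisomorphic R X Y → Nonempty (X ≃ₗ[R] Y)) →
      (∀ (X : Type u) [AddCommGroup X] [Module R X]
        (Y : Type u) [AddCommGroup Y] [Module R Y],
        IsNonsingularModule R X → IsExtendingModule R X →
        Subisomorphic R X Y → Nonempty (X ≃ₗ[R] Y)) := by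
    intro hb X _ _ Y _ _ hX _ hXY
    obtain ⟨g, hg⟩ := hXY.2
    exact hb X Y hX (nonsing_of_inj g hg hX) hXY
  have cb : IsSemisimpleRing (QuotBySecondSingular R) →
      (∀ (X : Type u) [AddCommGroup X] [Module R X]
        (Y : Type u) [AddCommGroup Y] [Module R Y],
        IsNonsingularModule R X → IsNonsingularModule R Y →
        Subisomorphic R X Y → Nonempty (X ≃ₗ[R] Y)) := by
    rintro hc X _ _ Y _ _ hX _ ⟨⟨f, hf⟩, g, hg⟩
    exact semisimple_SB (semisimple_of_nonsing (semisimple_iff.1 hc) hX) f hf g hg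
  exact ⟨⟨fun ha => cb (c_of_a ha), ba⟩, fun hb => c_of_a (ba hb), cb⟩
end
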